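/- The natural action of W on the set of 10-element cliques in C with weights in {1,3} has exactly 6 orbits. -/

import Mathlib

/-- The intersection pairing on `ℤ⁹`, the Picard lattice of a del Pezzo surface of degree 1. -/
def B (v w : Fin 9 → ℤ) : ℤ := v 0 * w 0 - ∑ i : Fin 8, v i.succ * w i.succ

/-- The canonical class `K = (-3, -1, …, -1)`. -/
def Kcl : Fin 9 → ℤ := fun i => if i = 0 then -3 else -1

/-- A vector is an exceptional class if `B(v,v) = -1` and `B(v,K) = -1`. -/
def IsExc (v : Fin 9 → ℤ) : Prop := B v v = -1 ∧ B v Kcl = -1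

/-- The type of exceptional classes (the set `C`). -/
abbrev Exc : Type := {v : Fin 9 → ℤ // IsExc v}

/-- The pairing on exceptional classes. -/
def Bx (x y : Exc) : ℤ := B x.1 y.1

/-- `S` is a clique with weights in `M` if `B(x,y) ∈ M` for all distinct `x, y ∈ S`. -/
def IsClique (M : Set ℤ) (S : Finset Exc) : Prop :=
  ∀ x ∈ S, ∀ y ∈ S, x ≠ y → Bx x y ∈ M

/-- A bijection of `C` preserving the pairing `B`: an element of the Weyl group `W`. -/
def PreservesB (g : Exc ≃ Exc) : Prop := ∀ x y : Exc, Bx (g x) (g y) = Bx x y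

/-- Two finite subsets of `C` lie in the same orbit of `W`. -/
def SameOrbit (S T : Finset Exc) : Prop :=
  ∃ g : Exc ≃ Exc, PreservesB g ∧ S.image g = T

/-! Part 1: the lattice and reflections. -/

theorem B_comm (u v : Fin 9 → ℤ) : B u v = B v u := by
  simp [B, mul_comm]

theorem B_add_smul (u w v : Fin 9 → ℤ) (c : ℤ) : B (u + c • w) v = B u v + c * B w v := by
  simp only [B, Pi.add_apply, Pi.smul_apply, smul_eq_mul, add_mul, Finset.sum_add_distrib,
    mul_sub, Finset.mul_sum, mul_assoc]
  ring

theorem B_smul_add (u w v : Fin 9 → ℤ) (c : ℤ) : B v (u + c • w) = B v u + c * B v w := by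
  rw [B_comm, B_add_smul, B_comm u, B_comm w]

theorem refl_invol (α : Fin 9 → ℤ) (h : B α α = -2) (v : Fin 9 → ℤ) :
    (v + B v α • α) + B (v + B v α • α) α • α = v := by
  rw [B_add_smul, h]
  ext i
  simp
  ring

theorem refl_pres (α : Fin 9 → ℤ) (h : B α α = -2) (v w : Fin 9 → ℤ) :
    B (v + B v α • α) (w + B w α • α) = B v w := by
  rw [B_add_smul, B_smul_add, B_smul_add, h, B_comm α w]
  ring

theorem refl_exc (α : Fin 9 → ℤ) (h : B α α = -2) (hK : B α Kcl = 0) (v : Fin 9 → ℤ)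
    (hv : IsExc v) : IsExc (v + B v α • α) := by
  refine ⟨by rw [refl_pres α h]; exact hv.1, ?_⟩
  rw [B_add_smul, hK, hv.2]
  ring

theorem refl_exists (α : Fin 9 → ℤ) (h : B α α = -2) (hK : B α Kcl = 0) :
    ∃ g : Exc ≃ Exc, PreservesB g ∧ ∀ x, (g x).1 = x.1 + B x.1 α • α := by
  refine ⟨⟨fun x => ⟨_, refl_exc α h hK x.1 x.2⟩, fun x => ⟨_, refl_exc α h hK x.1 x.2⟩,
    fun x => Subtype.ext (refl_invol α h x.1), fun x => Subtype.ext (refl_invol α h x.1)⟩,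
    fun x y => refl_pres α h x.1 y.1, fun x => rfl⟩

theorem pres_trans {g h : Exc ≃ Exc} (hg : PreservesB g) (hh : PreservesB h) :
    PreservesB (g.trans h) := fun x y => by
  simp only [Equiv.trans_apply]
  rw [hh, hg]

theorem pres_symm {g : Exc ≃ Exc} (hg : PreservesB g) : PreservesB g.symm := fun x y => by
  have := hg (g.symm x) (g.symm y)
  simpa using this.symm

theorem so_refl (S : Finset Exc) : SameOrbit S S :=
  ⟨Equiv.refl _, fun _ _ => rfl, by ext x; simp⟩

theorem so_symm {S T : Finset Exc} (h : SameOrbit S T) : SameOrbit T S := by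
  obtain ⟨g, hg, rfl⟩ := h
  exact ⟨g.symm, pres_symm hg, by rw [Finset.image_image]; simp⟩

theorem so_trans {S T U : Finset Exc} (h : SameOrbit S T) (h' : SameOrbit T U) :
    SameOrbit S U := by
  obtain ⟨g, hg, rfl⟩ := h
  obtain ⟨k, hk, rfl⟩ := h'
  exact ⟨g.trans k, pres_trans hg hk, by rw [Finset.image_image]; rfl⟩

theorem so_card {S T : Finset Exc} (h : SameOrbit S T) : T.card = S.card := by
  obtain ⟨g, hg, rfl⟩ := h
  exact Finset.card_image_of_injective _ g.injective

theorem so_clique {M : Set ℤ} {S T : Finset Exc} (h : SameOrbit S T) (hS : IsClique M S) :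
    IsClique M T := by
  obtain ⟨g, hg, rfl⟩ := h
  intro x hx y hy hxy
  obtain ⟨x, hx', rfl⟩ := Finset.mem_image.1 hx
  obtain ⟨y, hy', rfl⟩ := Finset.mem_image.1 hy
  rw [hg]
  exact hS x hx' y hy' (fun e => hxy (by rw [e]))

/-! Part 2: computable model with lists. -/

def toL (v : Fin 9 → ℤ) : List ℤ := [v 0, v 1, v 2, v 3, v 4, v 5, v 6, v 7, v 8]

def toV (l : List ℤ) : Fin 9 → ℤ := fun i => l.getD i.1 0

theorem toL_inj {u v : Fin 9 → ℤ} (h : toL u = toL v) : u = v := by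
  simp only [toL, List.cons.injEq] at h
  ext i
  fin_cases i <;> simp [h]

def dotL : List ℤ → List ℤ → ℤ
  | a :: u, b :: v => a * b + dotL u v
  | _, _ => 0

def Bl : List ℤ → List ℤ → ℤ
  | a :: u, b :: v => a * b - dotL u v
  | _, _ => 0

theorem Bl_toL (u v : Fin 9 → ℤ) : Bl (toL u) (toL v) = B u v := by
  simp only [Bl, toL, dotL, B, Fin.sum_univ_eight]
  simp
  ring

def KL : List ℤ := [-3, -1, -1, -1, -1, -1, -1, -1, -1]

theorem toL_K : toL Kcl = KL := by decide

def reflL (l α : List ℤ) : List ℤ :=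
  List.zipWith (fun x a => x + Bl l α * a) l α

theorem toL_refl (u α : Fin 9 → ℤ) : toL (u + B u α • α) = reflL (toL u) (toL α) := by
  rw [reflL, Bl_toL]
  simp [toL]

def rootOK (α : List ℤ) : Bool :=
  toL (toV α) == α && Bl α α == -2 && Bl α KL == 0

theorem word_exists (w : List (List ℤ)) (hw : w.all rootOK = true) :
    ∃ g : Exc ≃ Exc, PreservesB g ∧ ∀ x : Exc, toL (g x).1 = w.foldl reflL (toL x.1) := by
  induction w with
  | nil => exact ⟨Equiv.refl _, fun _ _ => rfl, fun _ => rfl⟩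
  | cons α w ih =>
    simp only [List.all_cons, Bool.and_eq_true] at hw
    obtain ⟨g, hg, hg'⟩ := ih hw.2
    have h := hw.1
    simp only [rootOK, Bool.and_eq_true, beq_iff_eq] at h
    obtain ⟨⟨h1, h2⟩, h3⟩ := h
    rw [← h1, Bl_toL] at h2
    rw [← h1, ← toL_K, Bl_toL] at h3
    obtain ⟨k, hk, hk'⟩ := refl_exists (toV α) h2 h3
    refine ⟨k.trans g, pres_trans hk hg, fun x => ?_⟩
    rw [Equiv.trans_apply, hg', hk', toL_refl, h1]
    rfl

/-! Part 3: enumeration of the exceptional classes. -/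

def enumL : ℕ → ℤ → ℤ → List (List ℤ)
  | 0, s, q => if s = 0 ∧ q = 0 then [[]] else []
  | n + 1, s, q => [-1, 0, 1, 2, 3].flatMap fun b =>
      if (s - b) * (s - b) ≤ (n : ℤ) * (q - b * b) then
        (enumL n (s - b) (q - b * b)).map (b :: ·) else []

def sqL (l : List ℤ) : ℤ := (l.map fun b => b * b).sum

theorem cs_list (l : List ℤ) : l.sum * l.sum ≤ (l.length : ℤ) * sqL l := by
  induction l with
  | nil => simp [sqL]
  | cons b l ih =>
    have e : sqL (b :: l) = b * b + sqL l := by simp [sqL]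
    rw [e, List.sum_cons, List.length_cons]
    push_cast
    rcases Nat.eq_zero_or_pos l.length with h0 | h0
    · have : l = [] := List.length_eq_zero_iff.1 h0
      subst this
      simp [sqL]
    · have hn : (0 : ℤ) < l.length := by exact_mod_cast h0
      generalize (l.length : ℤ) = n at *
      generalize l.sum = s at *
      generalize sqL l = q at *
      have key : 2 * b * s ≤ n * (b * b) + q := by
        by_contra! hc
        have : n * (n * (b * b) + q) < n * (2 * b * s) := mul_lt_mul_of_pos_left hc hn
        nlinarith [sq_nonneg (n * b - s)]
      nlinarith

theorem mem_enumL (l : List ℤ) (h : ∀ b ∈ l, -1 ≤ b ∧ b ≤ 3) :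
    l ∈ enumL l.length l.sum (sqL l) := by
  induction l with
  | nil => simp [enumL, sqL]
  | cons b l ih =>
    have e : sqL (b :: l) = b * b + sqL l := by simp [sqL]
    rw [e, List.sum_cons, List.length_cons, enumL, List.mem_flatMap]
    refine ⟨b, ?_, ?_⟩
    · have := h b (by simp)
      have : b = -1 ∨ b = 0 ∨ b = 1 ∨ b = 2 ∨ b = 3 := by omega
      simpa using this
    · have e1 : b + l.sum - b = l.sum := by ring
      have e2 : b * b + sqL l - b * b = sqL l := by ring
      rw [e1, e2, if_pos (cs_list l)]
      exact List.mem_map.2 ⟨l, ih (fun c hc => h c (by simp [hc])), rfl⟩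

def allEnum : List (List ℤ) :=
  [-1, 0, 1, 2, 3, 4, 5, 6, 7].flatMap fun a =>
    (enumL 8 (3 * a - 1) (a * a + 1)).map (a :: ·)

theorem exc_mem_enum (x : Exc) : toL x.1 ∈ allEnum := by
  obtain ⟨v, h1, h2⟩ := x
  have e1 : ∑ i : Fin 8, v i.succ = 3 * v 0 - 1 := by
    simp [B, Kcl] at h2
    linarith
  have e2 : ∑ i : Fin 8, v i.succ ^ 2 = v 0 ^ 2 + 1 := by
    simp only [B, ← pow_two] at h1
    linarith
  have ha : -1 ≤ v 0 ∧ v 0 ≤ 7 := by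
    have := sq_sum_le_card_mul_sum_sq (s := (Finset.univ : Finset (Fin 8)))
      (f := fun i => v i.succ)
    rw [e1, e2] at this
    simp at this
    constructor <;> nlinarith
  have hb : ∀ i : Fin 8, -1 ≤ v i.succ ∧ v i.succ ≤ 3 := by
    intro i
    have := sq_sum_le_card_mul_sum_sq (s := (Finset.univ : Finset (Fin 8)).erase i)
      (f := fun i => v i.succ)
    rw [Finset.card_erase_of_mem (Finset.mem_univ i)] at this
    have f1 := Finset.add_sum_erase Finset.univ (fun i : Fin 8 => v i.succ) (Finset.mem_univ i)
    have f2 := Finset.add_sum_erase Finset.univ (fun i : Fin 8 => v i.succ ^ 2)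
      (Finset.mem_univ i)
    rw [e1] at f1
    rw [e2] at f2
    rw [eq_sub_of_add_eq' f1, eq_sub_of_add_eq' f2] at this
    simp at this
    generalize v i.succ = b at *
    generalize v 0 = a at *
    have : 7 * ((b - 3) * (b + 1)) ≤ 0 := by nlinarith [sq_nonneg (2 * a - 3 - 3 * b)]
    constructor <;> nlinarith
  have hl := mem_enumL [v 1, v 2, v 3, v 4, v 5, v 6, v 7, v 8] (by
    intro b hb'
    simp at hb'
    rcases hb' with rfl | rfl | rfl | rfl | rfl | rfl | rfl | rfl
    · exact hb 0
    · exact hb 1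
    · exact hb 2
    · exact hb 3
    · exact hb 4
    · exact hb 5
    · exact hb 6
    · exact hb 7)
  have s1 : [v 1, v 2, v 3, v 4, v 5, v 6, v 7, v 8].sum = 3 * v 0 - 1 := by
    rw [← e1, Fin.sum_univ_eight]
    simp
    ring
  have s2 : sqL [v 1, v 2, v 3, v 4, v 5, v 6, v 7, v 8] = v 0 * v 0 + 1 := by
    rw [← pow_two, ← e2, Fin.sum_univ_eight]
    simp [sqL]
    ring
  rw [s1, s2] at hl
  refine List.mem_flatMap.2 ⟨v 0, ?_, List.mem_map.2 ⟨_, hl, rfl⟩⟩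
  have : v 0 = -1 ∨ v 0 = 0 ∨ v 0 = 1 ∨ v 0 = 2 ∨ v 0 = 3 ∨ v 0 = 4 ∨ v 0 = 5 ∨ v 0 = 6 ∨
    v 0 = 7 := by omega
  simpa using this

def all9 : List (List ℤ) :=
  [[0, -1, 0, 0, 0, 0, 0, 0, 0], [0, 0, -1, 0, 0, 0, 0, 0, 0], [0, 0, 0, -1, 0, 0, 0, 0, 0],
   [0, 0, 0, 0, -1, 0, 0, 0, 0], [0, 0, 0, 0, 0, -1, 0, 0, 0], [0, 0, 0, 0, 0, 0, -1, 0, 0],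
   [0, 0, 0, 0, 0, 0, 0, -1, 0], [0, 0, 0, 0, 0, 0, 0, 0, -1], [1, 0, 0, 0, 0, 0, 0, 1, 1],
   [1, 0, 0, 0, 0, 0, 1, 0, 1], [1, 0, 0, 0, 0, 0, 1, 1, 0], [1, 0, 0, 0, 0, 1, 0, 0, 1],
   [1, 0, 0, 0, 0, 1, 0, 1, 0], [1, 0, 0, 0, 0, 1, 1, 0, 0], [1, 0, 0, 0, 1, 0, 0, 0, 1],
   [1, 0, 0, 0, 1, 0, 0, 1, 0], [1, 0, 0, 0, 1, 0, 1, 0, 0], [1, 0, 0, 0, 1, 1, 0, 0, 0],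
   [1, 0, 0, 1, 0, 0, 0, 0, 1], [1, 0, 0, 1, 0, 0, 0, 1, 0], [1, 0, 0, 1, 0, 0, 1, 0, 0],
   [1, 0, 0, 1, 0, 1, 0, 0, 0], [1, 0, 0, 1, 1, 0, 0, 0, 0], [1, 0, 1, 0, 0, 0, 0, 0, 1],
   [1, 0, 1, 0, 0, 0, 0, 1, 0], [1, 0, 1, 0, 0, 0, 1, 0, 0], [1, 0, 1, 0, 0, 1, 0, 0, 0],
   [1, 0, 1, 0, 1, 0, 0, 0, 0], [1, 0, 1, 1, 0, 0, 0, 0, 0], [1, 1, 0, 0, 0, 0, 0, 0, 1],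
   [1, 1, 0, 0, 0, 0, 0, 1, 0], [1, 1, 0, 0, 0, 0, 1, 0, 0], [1, 1, 0, 0, 0, 1, 0, 0, 0],
   [1, 1, 0, 0, 1, 0, 0, 0, 0], [1, 1, 0, 1, 0, 0, 0, 0, 0], [1, 1, 1, 0, 0, 0, 0, 0, 0],
   [2, 0, 0, 0, 1, 1, 1, 1, 1], [2, 0, 0, 1, 0, 1, 1, 1, 1], [2, 0, 0, 1, 1, 0, 1, 1, 1],
   [2, 0, 0, 1, 1, 1, 0, 1, 1], [2, 0, 0, 1, 1, 1, 1, 0, 1], [2, 0, 0, 1, 1, 1, 1, 1, 0],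
   [2, 0, 1, 0, 0, 1, 1, 1, 1], [2, 0, 1, 0, 1, 0, 1, 1, 1], [2, 0, 1, 0, 1, 1, 0, 1, 1],
   [2, 0, 1, 0, 1, 1, 1, 0, 1], [2, 0, 1, 0, 1, 1, 1, 1, 0], [2, 0, 1, 1, 0, 0, 1, 1, 1],
   [2, 0, 1, 1, 0, 1, 0, 1, 1], [2, 0, 1, 1, 0, 1, 1, 0, 1], [2, 0, 1, 1, 0, 1, 1, 1, 0],
   [2, 0, 1, 1, 1, 0, 0, 1, 1], [2, 0, 1, 1, 1, 0, 1, 0, 1], [2, 0, 1, 1, 1, 0, 1, 1, 0],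
   [2, 0, 1, 1, 1, 1, 0, 0, 1], [2, 0, 1, 1, 1, 1, 0, 1, 0], [2, 0, 1, 1, 1, 1, 1, 0, 0],
   [2, 1, 0, 0, 0, 1, 1, 1, 1], [2, 1, 0, 0, 1, 0, 1, 1, 1], [2, 1, 0, 0, 1, 1, 0, 1, 1],
   [2, 1, 0, 0, 1, 1, 1, 0, 1], [2, 1, 0, 0, 1, 1, 1, 1, 0], [2, 1, 0, 1, 0, 0, 1, 1, 1],
   [2, 1, 0, 1, 0, 1, 0, 1, 1], [2, 1, 0, 1, 0, 1, 1, 0, 1], [2, 1, 0, 1, 0, 1, 1, 1, 0],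
   [2, 1, 0, 1, 1, 0, 0, 1, 1], [2, 1, 0, 1, 1, 0, 1, 0, 1], [2, 1, 0, 1, 1, 0, 1, 1, 0],
   [2, 1, 0, 1, 1, 1, 0, 0, 1], [2, 1, 0, 1, 1, 1, 0, 1, 0], [2, 1, 0, 1, 1, 1, 1, 0, 0],
   [2, 1, 1, 0, 0, 0, 1, 1, 1], [2, 1, 1, 0, 0, 1, 0, 1, 1], [2, 1, 1, 0, 0, 1, 1, 0, 1],
   [2, 1, 1, 0, 0, 1, 1, 1, 0], [2, 1, 1, 0, 1, 0, 0, 1, 1], [2, 1, 1, 0, 1, 0, 1, 0, 1],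
   [2, 1, 1, 0, 1, 0, 1, 1, 0], [2, 1, 1, 0, 1, 1, 0, 0, 1], [2, 1, 1, 0, 1, 1, 0, 1, 0],
   [2, 1, 1, 0, 1, 1, 1, 0, 0], [2, 1, 1, 1, 0, 0, 0, 1, 1], [2, 1, 1, 1, 0, 0, 1, 0, 1],
   [2, 1, 1, 1, 0, 0, 1, 1, 0], [2, 1, 1, 1, 0, 1, 0, 0, 1], [2, 1, 1, 1, 0, 1, 0, 1, 0],
   [2, 1, 1, 1, 0, 1, 1, 0, 0], [2, 1, 1, 1, 1, 0, 0, 0, 1], [2, 1, 1, 1, 1, 0, 0, 1, 0],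
   [2, 1, 1, 1, 1, 0, 1, 0, 0], [2, 1, 1, 1, 1, 1, 0, 0, 0], [3, 0, 1, 1, 1, 1, 1, 1, 2],
   [3, 0, 1, 1, 1, 1, 1, 2, 1], [3, 0, 1, 1, 1, 1, 2, 1, 1], [3, 0, 1, 1, 1, 2, 1, 1, 1],
   [3, 0, 1, 1, 2, 1, 1, 1, 1], [3, 0, 1, 2, 1, 1, 1, 1, 1], [3, 0, 2, 1, 1, 1, 1, 1, 1],
   [3, 1, 0, 1, 1, 1, 1, 1, 2], [3, 1, 0, 1, 1, 1, 1, 2, 1], [3, 1, 0, 1, 1, 1, 2, 1, 1],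
   [3, 1, 0, 1, 1, 2, 1, 1, 1], [3, 1, 0, 1, 2, 1, 1, 1, 1], [3, 1, 0, 2, 1, 1, 1, 1, 1],
   [3, 1, 1, 0, 1, 1, 1, 1, 2], [3, 1, 1, 0, 1, 1, 1, 2, 1], [3, 1, 1, 0, 1, 1, 2, 1, 1],
   [3, 1, 1, 0, 1, 2, 1, 1, 1], [3, 1, 1, 0, 2, 1, 1, 1, 1], [3, 1, 1, 1, 0, 1, 1, 1, 2],
   [3, 1, 1, 1, 0, 1, 1, 2, 1], [3, 1, 1, 1, 0, 1, 2, 1, 1], [3, 1, 1, 1, 0, 2, 1, 1, 1],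
   [3, 1, 1, 1, 1, 0, 1, 1, 2], [3, 1, 1, 1, 1, 0, 1, 2, 1], [3, 1, 1, 1, 1, 0, 2, 1, 1],
   [3, 1, 1, 1, 1, 1, 0, 1, 2], [3, 1, 1, 1, 1, 1, 0, 2, 1], [3, 1, 1, 1, 1, 1, 1, 0, 2],
   [3, 1, 1, 1, 1, 1, 1, 2, 0], [3, 1, 1, 1, 1, 1, 2, 0, 1], [3, 1, 1, 1, 1, 1, 2, 1, 0],
   [3, 1, 1, 1, 1, 2, 0, 1, 1], [3, 1, 1, 1, 1, 2, 1, 0, 1], [3, 1, 1, 1, 1, 2, 1, 1, 0],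
   [3, 1, 1, 1, 2, 0, 1, 1, 1], [3, 1, 1, 1, 2, 1, 0, 1, 1], [3, 1, 1, 1, 2, 1, 1, 0, 1],
   [3, 1, 1, 1, 2, 1, 1, 1, 0], [3, 1, 1, 2, 0, 1, 1, 1, 1], [3, 1, 1, 2, 1, 0, 1, 1, 1],
   [3, 1, 1, 2, 1, 1, 0, 1, 1], [3, 1, 1, 2, 1, 1, 1, 0, 1], [3, 1, 1, 2, 1, 1, 1, 1, 0],
   [3, 1, 2, 0, 1, 1, 1, 1, 1], [3, 1, 2, 1, 0, 1, 1, 1, 1], [3, 1, 2, 1, 1, 0, 1, 1, 1],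
   [3, 1, 2, 1, 1, 1, 0, 1, 1], [3, 1, 2, 1, 1, 1, 1, 0, 1], [3, 1, 2, 1, 1, 1, 1, 1, 0],
   [3, 2, 0, 1, 1, 1, 1, 1, 1], [3, 2, 1, 0, 1, 1, 1, 1, 1], [3, 2, 1, 1, 0, 1, 1, 1, 1],
   [3, 2, 1, 1, 1, 0, 1, 1, 1], [3, 2, 1, 1, 1, 1, 0, 1, 1], [3, 2, 1, 1, 1, 1, 1, 0, 1],
   [3, 2, 1, 1, 1, 1, 1, 1, 0], [4, 1, 1, 1, 1, 1, 2, 2, 2], [4, 1, 1, 1, 1, 2, 1, 2, 2],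
   [4, 1, 1, 1, 1, 2, 2, 1, 2], [4, 1, 1, 1, 1, 2, 2, 2, 1], [4, 1, 1, 1, 2, 1, 1, 2, 2],
   [4, 1, 1, 1, 2, 1, 2, 1, 2], [4, 1, 1, 1, 2, 1, 2, 2, 1], [4, 1, 1, 1, 2, 2, 1, 1, 2],
   [4, 1, 1, 1, 2, 2, 1, 2, 1], [4, 1, 1, 1, 2, 2, 2, 1, 1], [4, 1, 1, 2, 1, 1, 1, 2, 2],
   [4, 1, 1, 2, 1, 1, 2, 1, 2], [4, 1, 1, 2, 1, 1, 2, 2, 1], [4, 1, 1, 2, 1, 2, 1, 1, 2],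
   [4, 1, 1, 2, 1, 2, 1, 2, 1], [4, 1, 1, 2, 1, 2, 2, 1, 1], [4, 1, 1, 2, 2, 1, 1, 1, 2],
   [4, 1, 1, 2, 2, 1, 1, 2, 1], [4, 1, 1, 2, 2, 1, 2, 1, 1], [4, 1, 1, 2, 2, 2, 1, 1, 1],
   [4, 1, 2, 1, 1, 1, 1, 2, 2], [4, 1, 2, 1, 1, 1, 2, 1, 2], [4, 1, 2, 1, 1, 1, 2, 2, 1],
   [4, 1, 2, 1, 1, 2, 1, 1, 2], [4, 1, 2, 1, 1, 2, 1, 2, 1], [4, 1, 2, 1, 1, 2, 2, 1, 1],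
   [4, 1, 2, 1, 2, 1, 1, 1, 2], [4, 1, 2, 1, 2, 1, 1, 2, 1], [4, 1, 2, 1, 2, 1, 2, 1, 1],
   [4, 1, 2, 1, 2, 2, 1, 1, 1], [4, 1, 2, 2, 1, 1, 1, 1, 2], [4, 1, 2, 2, 1, 1, 1, 2, 1],
   [4, 1, 2, 2, 1, 1, 2, 1, 1], [4, 1, 2, 2, 1, 2, 1, 1, 1], [4, 1, 2, 2, 2, 1, 1, 1, 1],
   [4, 2, 1, 1, 1, 1, 1, 2, 2], [4, 2, 1, 1, 1, 1, 2, 1, 2], [4, 2, 1, 1, 1, 1, 2, 2, 1],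
   [4, 2, 1, 1, 1, 2, 1, 1, 2], [4, 2, 1, 1, 1, 2, 1, 2, 1], [4, 2, 1, 1, 1, 2, 2, 1, 1],
   [4, 2, 1, 1, 2, 1, 1, 1, 2], [4, 2, 1, 1, 2, 1, 1, 2, 1], [4, 2, 1, 1, 2, 1, 2, 1, 1],
   [4, 2, 1, 1, 2, 2, 1, 1, 1], [4, 2, 1, 2, 1, 1, 1, 1, 2], [4, 2, 1, 2, 1, 1, 1, 2, 1],
   [4, 2, 1, 2, 1, 1, 2, 1, 1], [4, 2, 1, 2, 1, 2, 1, 1, 1], [4, 2, 1, 2, 2, 1, 1, 1, 1],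
   [4, 2, 2, 1, 1, 1, 1, 1, 2], [4, 2, 2, 1, 1, 1, 1, 2, 1], [4, 2, 2, 1, 1, 1, 2, 1, 1],
   [4, 2, 2, 1, 1, 2, 1, 1, 1], [4, 2, 2, 1, 2, 1, 1, 1, 1], [4, 2, 2, 2, 1, 1, 1, 1, 1],
   [5, 1, 1, 2, 2, 2, 2, 2, 2], [5, 1, 2, 1, 2, 2, 2, 2, 2], [5, 1, 2, 2, 1, 2, 2, 2, 2],
   [5, 1, 2, 2, 2, 1, 2, 2, 2], [5, 1, 2, 2, 2, 2, 1, 2, 2], [5, 1, 2, 2, 2, 2, 2, 1, 2],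
   [5, 1, 2, 2, 2, 2, 2, 2, 1], [5, 2, 1, 1, 2, 2, 2, 2, 2], [5, 2, 1, 2, 1, 2, 2, 2, 2],
   [5, 2, 1, 2, 2, 1, 2, 2, 2], [5, 2, 1, 2, 2, 2, 1, 2, 2], [5, 2, 1, 2, 2, 2, 2, 1, 2],
   [5, 2, 1, 2, 2, 2, 2, 2, 1], [5, 2, 2, 1, 1, 2, 2, 2, 2], [5, 2, 2, 1, 2, 1, 2, 2, 2],
   [5, 2, 2, 1, 2, 2, 1, 2, 2], [5, 2, 2, 1, 2, 2, 2, 1, 2], [5, 2, 2, 1, 2, 2, 2, 2, 1],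
   [5, 2, 2, 2, 1, 1, 2, 2, 2], [5, 2, 2, 2, 1, 2, 1, 2, 2], [5, 2, 2, 2, 1, 2, 2, 1, 2],
   [5, 2, 2, 2, 1, 2, 2, 2, 1], [5, 2, 2, 2, 2, 1, 1, 2, 2], [5, 2, 2, 2, 2, 1, 2, 1, 2],
   [5, 2, 2, 2, 2, 1, 2, 2, 1], [5, 2, 2, 2, 2, 2, 1, 1, 2], [5, 2, 2, 2, 2, 2, 1, 2, 1],
   [5, 2, 2, 2, 2, 2, 2, 1, 1], [6, 2, 2, 2, 2, 2, 2, 2, 3], [6, 2, 2, 2, 2, 2, 2, 3, 2],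
   [6, 2, 2, 2, 2, 2, 3, 2, 2], [6, 2, 2, 2, 2, 3, 2, 2, 2], [6, 2, 2, 2, 3, 2, 2, 2, 2],
   [6, 2, 2, 3, 2, 2, 2, 2, 2], [6, 2, 3, 2, 2, 2, 2, 2, 2], [6, 3, 2, 2, 2, 2, 2, 2, 2]]

theorem allEnum_eq : allEnum = all9 := by decide +kernel

theorem exc_mem (x : Exc) : toL x.1 ∈ all9 := allEnum_eq ▸ exc_mem_enum x

theorem all9_ok : (all9.all fun l => toL (toV l) == l && Bl l l == -1 && Bl l KL == -1) = true := by
  decide +kernel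

theorem mem_exc {l : List ℤ} (hl : l ∈ all9) : ∃ x : Exc, toL x.1 = l := by
  have h := List.all_eq_true.1 all9_ok l hl
  simp only [Bool.and_eq_true, beq_iff_eq] at h
  obtain ⟨⟨h1, h2⟩, h3⟩ := h
  rw [← h1, Bl_toL] at h2
  rw [← h1, ← toL_K, Bl_toL] at h3
  exact ⟨⟨toV l, h2, h3⟩, h1⟩

theorem exc_ext {x y : Exc} (h : toL x.1 = toL y.1) : x = y := Subtype.ext (toL_inj h)

theorem Bx_eq (x y : Exc) : Bx x y = Bl (toL x.1) (toL y.1) := (Bl_toL _ _).symm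

/-! Part 4: moving elements into standard position. -/

theorem move (x z : Exc) (h : Bx x z = 0) :
    ∃ g : Exc ≃ Exc, PreservesB g ∧ g x = z ∧ ∀ c, Bx x c = Bx z c → g c = c := by
  have ha : ∀ v, B (x.1 + (-1 : ℤ) • z.1) v = B x.1 v - B z.1 v := fun v => by
    rw [B_add_smul]; ring
  have hzx : B z.1 x.1 = 0 := by rw [B_comm]; exact h
  have hxz : B x.1 z.1 = 0 := h
  have hb : ∀ v, B v (x.1 + (-1 : ℤ) • z.1) = B x.1 v - B z.1 v := fun v => by
    rw [B_comm, ha]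
  obtain ⟨g, hg, hg'⟩ := refl_exists (x.1 + (-1 : ℤ) • z.1)
    (by rw [ha, hb, hb, x.2.1, z.2.1, hzx, hxz]; norm_num) (by rw [ha, x.2.2, z.2.2]; norm_num)
  refine ⟨g, hg, Subtype.ext ?_, fun c hc => Subtype.ext ?_⟩
  · rw [hg', hb, hzx, x.2.1]
    ext i
    simp
  · have : B x.1 c.1 = B z.1 c.1 := hc
    rw [hg', hb, this]
    simp

def Mv (cs : List (List ℤ)) (x t : Exc) : Prop :=
  ∃ g : Exc ≃ Exc, PreservesB g ∧ g x = t ∧ ∀ c : Exc, toL c.1 ∈ cs → g c = c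

theorem Mv.refl (cs : List (List ℤ)) (x : Exc) : Mv cs x x :=
  ⟨Equiv.refl _, fun _ _ => rfl, rfl, fun _ _ => rfl⟩

theorem Mv.trans {cs : List (List ℤ)} {x y z : Exc} (h : Mv cs x y) (h' : Mv cs y z) :
    Mv cs x z := by
  obtain ⟨g, hg, h1, h2⟩ := h
  obtain ⟨k, hk, h3, h4⟩ := h'
  exact ⟨g.trans k, pres_trans hg hk, by simp [h1, h3], fun c hc => by
    rw [Equiv.trans_apply, h2 c hc, h4 c hc]⟩

def perpOK (cs : List (List ℤ)) (x : List ℤ) : Bool := cs.all fun c => Bl x c == 1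

theorem Mv.step {cs : List (List ℤ)} {x z : Exc} (hx : perpOK cs (toL x.1) = true)
    (hz : perpOK cs (toL z.1) = true) (h : Bl (toL x.1) (toL z.1) = 0) : Mv cs x z := by
  obtain ⟨g, hg, h1, h2⟩ := move x z (by rw [Bx_eq, h])
  refine ⟨g, hg, h1, fun c hc => h2 c ?_⟩
  have e1 := List.all_eq_true.1 hx _ hc
  have e2 := List.all_eq_true.1 hz _ hc
  simp only [beq_iff_eq] at e1 e2
  rw [Bx_eq, Bx_eq, e1, e2]

def perpL (cs : List (List ℤ)) : List (List ℤ) := all9.filter (perpOK cs)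

def stageOK (cs : List (List ℤ)) (t : List ℤ) (bad : List (List ℤ)) : Bool :=
  perpOK cs t && (perpL cs).all fun x => bad.contains x || x == t || Bl x t == 0 ||
    (perpL cs).any fun z => Bl x z == 0 && (Bl z t == 0 ||
      (Bl x t == 3 && (perpL cs).any fun y => Bl z y == 0 && Bl y t == 0))

def exclL (cs bad : List (List ℤ)) : List (List ℤ) :=
  all9.filter fun x => bad.contains x || cs.any fun c => x == c || Bl x c == 3

theorem stage_mv {cs : List (List ℤ)} {bad : List (List ℤ)} {x t : Exc}
    (h : stageOK cs (toL t.1) bad = true) (hx : perpOK cs (toL x.1) = true)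
    (hb : toL x.1 ∉ bad) : Mv cs x t := by
  simp only [stageOK, Bool.and_eq_true] at h
  obtain ⟨ht, h⟩ := h
  have h := List.all_eq_true.1 h (toL x.1) (List.mem_filter.2 ⟨exc_mem x, hx⟩)
  simp only [Bool.or_eq_true, beq_iff_eq, List.any_eq_true, Bool.and_eq_true,
    List.contains_iff_mem] at h
  rcases h with ((h | h) | h) | ⟨z, hz, h1, h2⟩
  · exact absurd h hb
  · rw [exc_ext h]
    exact Mv.refl _ _
  · exact Mv.step hx ht h
  · obtain ⟨hz1, hz2⟩ := List.mem_filter.1 hz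
    obtain ⟨z, rfl⟩ := mem_exc hz1
    refine (Mv.step hx hz2 h1).trans ?_
    rcases h2 with h2 | ⟨-, y, hy, h3, h4⟩
    · exact Mv.step hz2 ht h2
    · obtain ⟨hy1, hy2⟩ := List.mem_filter.1 hy
      obtain ⟨y, rfl⟩ := mem_exc hy1
      exact (Mv.step hz2 hy2 h3).trans (Mv.step hy2 ht h4)

theorem stage (cs : List (List ℤ)) (t : List ℤ) (bad : List (List ℤ)) (hcs : t ∈ all9)
    (hcs' : ∀ c ∈ cs, c ∈ all9)
    (h1 : stageOK cs t bad = true) (h2 : (exclL cs bad).length < 10)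
    (S : Finset Exc) (hS : S.card = 10) (hc : IsClique {1, 3} S)
    (hm : ∀ c : Exc, toL c.1 ∈ cs → c ∈ S) :
    ∃ S', SameOrbit S S' ∧ S'.card = 10 ∧ IsClique {1, 3} S' ∧
      ∀ c : Exc, toL c.1 ∈ t :: cs → c ∈ S' := by
  obtain ⟨t, rfl⟩ := mem_exc hcs
  have hex : ∃ x ∈ S, toL x.1 ∉ exclL cs bad := by
    by_contra! hcon
    have hi : S.card = (S.image fun x : Exc => toL x.1).card :=
      (Finset.card_image_of_injective _ fun a b hab => exc_ext hab).symm
    have hsub : (S.image fun x : Exc => toL x.1) ⊆ (exclL cs bad).toFinset := by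
      intro l hl
      obtain ⟨x, hx, rfl⟩ := Finset.mem_image.1 hl
      exact List.mem_toFinset.2 (hcon x hx)
    have := Finset.card_le_card hsub
    have := List.toFinset_card_le (exclL cs bad)
    omega
  obtain ⟨x, hxS, hx⟩ := hex
  have hx' : ¬ (toL x.1 ∈ bad ∨ ∃ c ∈ cs, toL x.1 = c ∨ Bl (toL x.1) c = 3) := by
    intro hcon
    apply hx
    refine List.mem_filter.2 ⟨exc_mem x, ?_⟩
    simpa only [Bool.or_eq_true, beq_iff_eq, List.any_eq_true, List.contains_iff_mem] using hcon
  push Not at hx'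
  obtain ⟨hb, hx'⟩ := hx'
  have hp : perpOK cs (toL x.1) = true := by
    refine List.all_eq_true.2 fun c hcc => ?_
    obtain ⟨c, rfl⟩ := mem_exc (hcs' c hcc)
    obtain ⟨h3, h4⟩ := hx' _ hcc
    have := hc x hxS c (hm c hcc) (fun e => h3 (by rw [e]))
    rw [Bx_eq] at this
    simp only [Set.mem_insert_iff, Set.mem_singleton_iff] at this
    simpa using this.resolve_right h4
  obtain ⟨g, hg, hgx, hgc⟩ := stage_mv h1 hp hb
  have hso : SameOrbit S (S.image g) := ⟨g, hg, rfl⟩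
  refine ⟨S.image g, hso, by rw [so_card hso, hS], so_clique hso hc, fun c hcm => ?_⟩
  rcases List.mem_cons.1 hcm with e | e
  · rw [exc_ext e, ← hgx]
    exact Finset.mem_image_of_mem _ hxS
  · rw [← hgc c e]
    exact Finset.mem_image_of_mem _ (hm c e)

def FL : List (List ℤ) := [[0, -1, 0, 0, 0, 0, 0, 0, 0], [1, 1, 0, 0, 0, 0, 0, 0, 1],
  [2, 1, 0, 0, 1, 1, 1, 1, 0], [3, 1, 0, 2, 1, 1, 1, 1, 1], [2, 1, 1, 1, 0, 0, 1, 1, 0],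
  [3, 1, 1, 1, 0, 2, 1, 1, 1], [2, 1, 1, 1, 1, 1, 0, 0, 0], [3, 1, 1, 1, 1, 1, 0, 2, 1],
  [6, 3, 2, 2, 2, 2, 2, 2, 2], [5, 1, 2, 2, 2, 2, 2, 2, 1], [4, 1, 2, 2, 1, 1, 1, 1, 2],
  [3, 1, 2, 0, 1, 1, 1, 1, 1], [4, 1, 1, 1, 2, 2, 1, 1, 2], [3, 1, 1, 1, 2, 0, 1, 1, 1],
  [4, 1, 1, 1, 1, 1, 2, 2, 2], [3, 1, 1, 1, 1, 1, 2, 0, 1]]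

def fl (i : ℕ) : List ℤ := FL.getD i [0, -1, 0, 0, 0, 0, 0, 0, 0]

theorem FL_mem : (FL.all fun l => all9.contains l) = true := by decide +kernel

theorem fl_mem (i : ℕ) : fl i ∈ all9 := by
  have h : ∀ l ∈ FL, l ∈ all9 := fun l hl => by
    simpa only [List.contains_iff_mem] using List.all_eq_true.1 FL_mem l hl
  by_cases hi : i < FL.length
  · rw [fl, List.getD_eq_getElem _ _ hi]
    exact h _ (List.getElem_mem hi)
  · rw [fl, List.getD_eq_default _ _ (by omega)]
    exact h _ (by simp [FL])

theorem st1 : stageOK [] (fl 0) [] = true := by decide +kernel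
theorem st2 : stageOK [fl 0] (fl 1) [] = true := by decide +kernel
theorem st3 : stageOK [fl 1, fl 0] (fl 2) [] = true := by decide +kernel
theorem st4 : stageOK [fl 2, fl 1, fl 0] (fl 4) [fl 3, fl 11] = true := by decide +kernel
theorem ex1 : (exclL [] []).length < 10 := by decide +kernel
theorem ex2 : (exclL [fl 0] []).length < 10 := by decide +kernel
theorem ex3 : (exclL [fl 1, fl 0] []).length < 10 := by decide +kernel
theorem ex4 : (exclL [fl 2, fl 1, fl 0] [fl 3, fl 11]).length < 10 := by decide +kernel

def inFrame : Bool := all9.all fun x => FL.contains x ||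
  ([fl 4, fl 2, fl 1, fl 0].any fun c => !(Bl x c == 1 || Bl x c == 3 || x == c))

theorem inFrame_ok : inFrame = true := by decide +kernel

theorem to_frame (S : Finset Exc) (hS : S.card = 10) (hc : IsClique {1, 3} S) :
    ∃ S', SameOrbit S S' ∧ S'.card = 10 ∧ ∀ x ∈ S', toL x.1 ∈ FL := by
  obtain ⟨S1, o1, k1, c1, m1⟩ := stage [] (fl 0) [] (fl_mem 0) (by simp) st1 ex1 S hS hc (by simp)
  obtain ⟨S2, o2, k2, c2, m2⟩ := stage _ (fl 1) [] (fl_mem 1) (by simp [fl_mem]) st2 ex2 S1 k1 c1 m1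
  obtain ⟨S3, o3, k3, c3, m3⟩ := stage _ (fl 2) [] (fl_mem 2) (by simp [fl_mem]) st3 ex3 S2 k2 c2 m2
  obtain ⟨S4, o4, k4, c4, m4⟩ := stage _ (fl 4) [fl 3, fl 11] (fl_mem 4) (by simp [fl_mem])
    st4 ex4 S3 k3 c3 m3
  refine ⟨S4, so_trans o1 (so_trans o2 (so_trans o3 o4)), k4, fun x hx => ?_⟩
  have h := List.all_eq_true.1 inFrame_ok _ (exc_mem x)
  rw [Bool.or_eq_true, List.contains_iff_mem] at h
  rcases h with h | h
  · exact h
  · exfalso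
    obtain ⟨c, hcm, h⟩ := List.any_eq_true.1 h
    have hc9 : c ∈ all9 := by
      simp only [List.mem_cons, List.not_mem_nil, or_false] at hcm
      rcases hcm with rfl | rfl | rfl | rfl <;> exact fl_mem _
    obtain ⟨c, rfl⟩ := mem_exc hc9
    have hcS := m4 c hcm
    simp only [Bool.not_eq_true', Bool.or_eq_false_iff, beq_eq_false_iff_ne] at h
    have := c4 x hx c hcS (fun e => h.2 (by rw [e]))
    rw [Bx_eq] at this
    simp only [Set.mem_insert_iff, Set.mem_singleton_iff] at this
    tauto

/-! Part 5: subsets of the frame as bit masks. -/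

theorem f_exists (i : ℕ) : ∃ x : Exc, toL x.1 = fl i := mem_exc (fl_mem i)

noncomputable def f (i : ℕ) : Exc := (f_exists i).choose

theorem toL_f (i : ℕ) : toL (f i).1 = fl i := (f_exists i).choose_spec

theorem fl_inj : ∀ i < 16, ∀ j < 16, fl i = fl j → i = j := by decide +kernel

theorem f_inj {i j : ℕ} (hi : i < 16) (hj : j < 16) (h : f i = f j) : i = j :=
  fl_inj i hi j hj (by rw [← toL_f, ← toL_f, h])

def bitsF (m : ℕ) : Finset ℕ := (Finset.range 16).filter fun i => m.testBit i = true

noncomputable def setOfMask (m : ℕ) : Finset Exc := (bitsF m).image f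

theorem bitsF_lt {m i : ℕ} (h : i ∈ bitsF m) : i < 16 :=
  Finset.mem_range.1 (Finset.mem_filter.1 h).1

theorem f_injOn (m : ℕ) : Set.InjOn f (bitsF m : Set ℕ) := fun _ ha _ hb h =>
  f_inj (bitsF_lt ha) (bitsF_lt hb) h

theorem card_setOfMask (m : ℕ) : (setOfMask m).card = (bitsF m).card :=
  Finset.card_image_of_injOn (f_injOn m)

theorem exists_mask (S : Finset Exc) (h : ∀ x ∈ S, toL x.1 ∈ FL) :
    ∃ m, (∀ i, 16 ≤ i → m.testBit i = false) ∧ S = setOfMask m := by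
  classical
  refine ⟨Nat.ofBits fun i : Fin 16 => decide (f i.1 ∈ S), fun i hi => ?_, ?_⟩
  · exact Nat.testBit_ofBits_ge _ _ hi
  · ext x
    simp only [setOfMask, bitsF, Finset.mem_image, Finset.mem_filter, Finset.mem_range]
    constructor
    · intro hx
      obtain ⟨i, hi, e⟩ := List.getElem_of_mem (h x hx)
      have hi16 : i < 16 := hi
      have e' : f i = x := exc_ext (by rw [toL_f, fl, List.getD_eq_getElem _ _ hi, e])
      refine ⟨i, ⟨hi16, ?_⟩, e'⟩
      rw [Nat.testBit_ofBits_lt _ _ hi16]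
      simpa [e'] using hx
    · rintro ⟨i, ⟨hi, hb⟩, rfl⟩
      rw [Nat.testBit_ofBits_lt _ _ hi] at hb
      simpa using hb

def tb (m i : ℕ) : ℕ := Nat.land 1 (Nat.shiftRight m i)

def swapBits (m : ℕ) (ab : ℕ × ℕ) : ℕ :=
  cond (Nat.beq (tb m ab.1) (tb m ab.2)) m (Nat.xor (Nat.xor m (Nat.pow 2 ab.1)) (Nat.pow 2 ab.2))

theorem tb_eq (m i : ℕ) : tb m i = (m.testBit i).toNat := by
  have : tb m i = 1 &&& (m >>> i) := rfl
  rw [this, Nat.testBit, Nat.one_and_eq_mod_two]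
  rcases Nat.mod_two_eq_zero_or_one (m >>> i) with h | h <;> simp [h]

theorem swapBits_eq (m a b : ℕ) : swapBits m (a, b) =
    if m.testBit a == m.testBit b then m else (m ^^^ (2 ^ a)) ^^^ (2 ^ b) := by
  unfold swapBits
  simp only [tb_eq]
  cases m.testBit a <;> cases m.testBit b <;> rfl

theorem testBit_swapBits (m a b i : ℕ) :
    (swapBits m (a, b)).testBit i = m.testBit (Equiv.swap a b i) := by
  rw [swapBits_eq]
  split_ifs with h
  · rw [beq_iff_eq] at h
    rw [Equiv.swap_apply_def]
    split_ifs with h1 h2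
    · rw [h1, h]
    · rw [h2, h]
    · rfl
  · have hab : a ≠ b := fun e => h (by simp [e])
    rw [beq_iff_eq] at h
    rw [Nat.testBit_xor, Nat.testBit_xor, Nat.testBit_two_pow, Nat.testBit_two_pow,
      Equiv.swap_apply_def]
    split_ifs with h1 h2
    · subst h1
      have : b ≠ i := fun e => hab e.symm
      simp only [this]
      revert h
      cases m.testBit i <;> cases m.testBit b <;> simp
    · subst h2
      simp only [hab]
      revert h
      cases m.testBit a <;> cases m.testBit i <;> simp
    · have h1' : a ≠ i := fun e => h1 e.symm
      have h2' : b ≠ i := fun e => h2 e.symm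
      simp [h1', h2']

theorem bitsF_swap (m a b : ℕ) (ha : a < 16) (hb : b < 16) :
    bitsF (swapBits m (a, b)) = (bitsF m).image (Equiv.swap a b) := by
  have hlt : ∀ i < 16, Equiv.swap a b i < 16 := by
    intro i hi
    rw [Equiv.swap_apply_def]
    split_ifs <;> assumption
  ext i
  simp only [bitsF, Finset.mem_image, Finset.mem_filter, Finset.mem_range, testBit_swapBits]
  constructor
  · rintro ⟨h1, h2⟩
    exact ⟨Equiv.swap a b i, ⟨hlt i h1, h2⟩, Equiv.swap_apply_self _ _ _⟩
  · rintro ⟨j, ⟨h1, h2⟩, rfl⟩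
    refine ⟨hlt j h1, ?_⟩
    rw [Equiv.swap_apply_self]
    exact h2

def swp (i : ℕ) (ab : ℕ × ℕ) : ℕ := if i = ab.1 then ab.2 else if i = ab.2 then ab.1 else i

theorem bitsF_swaps (sw : List (ℕ × ℕ)) (h : ∀ ab ∈ sw, ab.1 < 16 ∧ ab.2 < 16) (m : ℕ) :
    bitsF (sw.foldl swapBits m) = (bitsF m).image (fun i => sw.foldl swp i) ∧
    (bitsF (sw.foldl swapBits m)).card = (bitsF m).card := by
  induction sw generalizing m with
  | nil => simp
  | cons ab sw ih =>
    obtain ⟨a, b⟩ := ab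
    have hab := h (a, b) (by simp)
    obtain ⟨i1, i2⟩ := ih (fun x hx => h x (by simp [hx])) (swapBits m (a, b))
    have e : (⇑(Equiv.swap a b) : ℕ → ℕ) = fun i => swp i (a, b) := by
      ext i
      rw [Equiv.swap_apply_def]
      rfl
    rw [List.foldl_cons]
    constructor
    · rw [i1, bitsF_swap m a b hab.1 hab.2, Finset.image_image, e]
      rfl
    · rw [i2, bitsF_swap m a b hab.1 hab.2]
      exact Finset.card_image_of_injective _ (Equiv.injective _)

abbrev Gen := List (List ℤ) × List (ℕ × ℕ)

def genOK (G : Gen) : Bool :=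
  G.1.all rootOK && (G.2.all fun ab => decide (ab.1 < 16) && decide (ab.2 < 16)) &&
    (List.range 16).all fun i => G.1.foldl reflL (fl i) == fl (G.2.foldl swp i)

theorem gen_orbit (G : Gen) (h : genOK G = true) (m : ℕ) :
    SameOrbit (setOfMask m) (setOfMask (G.2.foldl swapBits m)) ∧
      (bitsF (G.2.foldl swapBits m)).card = (bitsF m).card := by
  simp only [genOK, Bool.and_eq_true] at h
  obtain ⟨⟨h1, h2⟩, h3⟩ := h
  have h2' : ∀ ab ∈ G.2, ab.1 < 16 ∧ ab.2 < 16 := fun ab hab => by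
    simpa using List.all_eq_true.1 h2 ab hab
  obtain ⟨b1, b2⟩ := bitsF_swaps G.2 h2' m
  refine ⟨?_, b2⟩
  obtain ⟨g, hg, hg'⟩ := word_exists G.1 h1
  refine ⟨g, hg, ?_⟩
  rw [setOfMask, setOfMask, b1, Finset.image_image, Finset.image_image]
  refine Finset.image_congr fun i hi => ?_
  have := List.all_eq_true.1 h3 i (List.mem_range.2 (bitsF_lt hi))
  rw [beq_iff_eq] at this
  exact exc_ext (by simp only [Function.comp_apply]; rw [hg', toL_f, toL_f, this])

def addL (u v : List ℤ) : List ℤ := List.zipWith (· + ·) u v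
def subL (u v : List ℤ) : List ℤ := List.zipWith (· - ·) u v

def flipG (i : ℕ) : Gen := ([addL (fl i) KL], [(i, i + 8)])

def transG (q : ℕ × ℕ × ℕ × ℕ) : Gen :=
  let (i, j, k, l) := q
  ([(addL (subL (fl i) (fl j)) (subL (fl k) (fl l))).map (· / 2),
    (subL (subL (fl i) (fl j)) (subL (fl k) (fl l))).map (· / 2)],
   [(i, j), (k, l), (i + 8, j + 8), (k + 8, l + 8)])

def gens : List Gen := (List.range 8).map flipG ++
  [(0, 1, 2, 3), (0, 2, 1, 3), (0, 3, 1, 2), (0, 1, 4, 5), (0, 4, 1, 5), (0, 5, 1, 4),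
   (0, 1, 6, 7), (0, 6, 1, 7), (0, 2, 4, 6), (0, 4, 2, 6), (0, 2, 5, 7), (0, 4, 3, 7),
   (0, 3, 5, 6), (0, 5, 3, 6), (1, 2, 4, 7), (1, 4, 2, 7), (1, 2, 5, 6), (1, 4, 3, 6),
   (2, 4, 3, 5)].map transG

theorem gens_ok : gens.all genOK = true := by decide +kernel

def mins : List ℕ := [0x3ff, 0x77f, 0x7f7, 0xf3f, 0x173f, 0x1f1f]

def sws : List (List (ℕ × ℕ)) :=
  [[(0, 8)], [(1, 9)], [(2, 10)], [(3, 11)], [(4, 12)], [(5, 13)], [(6, 14)], [(7, 15)], [(0,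
   1), (2, 3), (8, 9), (10, 11)], [(0, 2), (1, 3), (8, 10), (9, 11)], [(0, 3), (1, 2), (8, 11),
   (9, 10)], [(0, 1), (4, 5), (8, 9), (12, 13)], [(0, 4), (1, 5), (8, 12), (9, 13)], [(0, 5),
   (1, 4), (8, 13), (9, 12)], [(0, 1), (6, 7), (8, 9), (14, 15)], [(0, 6), (1, 7), (8, 14), (9,
   15)], [(0, 2), (4, 6), (8, 10), (12, 14)], [(0, 4), (2, 6), (8, 12), (10, 14)], [(0, 2), (5,
   7), (8, 10), (13, 15)], [(0, 4), (3, 7), (8, 12), (11, 15)], [(0, 3), (5, 6), (8, 11), (13,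
   14)], [(0, 5), (3, 6), (8, 13), (11, 14)], [(1, 2), (4, 7), (9, 10), (12, 15)], [(1, 4), (2,
   7), (9, 12), (10, 15)], [(1, 2), (5, 6), (9, 10), (13, 14)], [(1, 4), (3, 6), (9, 12), (11,
   14)], [(2, 4), (3, 5), (10, 12), (11, 13)]]

theorem sws_eq : sws = gens.map (fun G => G.2) := by decide +kernel

def testM (m : ℕ) : Bool := sws.any (fun G => Nat.blt (G.foldl swapBits m) m) || mins.contains m

def chk : ℕ → ℕ → ℕ → Bool
  | 0, _, m => testM m
  | n + 1, c, m => Nat.blt (n + 1) c || (chk n c m &&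
      (Nat.beq c 0 || chk n (c - 1) (m ||| 2 ^ n)))

theorem chk_spec (n : ℕ) : ∀ c m, chk n c m = true → (∀ i < n, m.testBit i = false) →
    ∀ m', (∀ i, n ≤ i → m'.testBit i = m.testBit i) →
    ((Finset.range n).filter fun i => m'.testBit i = true).card = c → testM m' = true := by
  induction n with
  | zero =>
    intro c m h _ m' h' _
    have : m' = m := Nat.eq_of_testBit_eq fun i => h' i (Nat.zero_le _)
    rw [this]
    exact h
  | succ n ih =>
    intro c m h h0 m' h' hc
    have hle : c ≤ n + 1 := by
      rw [← hc]
      exact (Finset.card_filter_le _ _).trans (by simp)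
    rw [chk, Bool.or_eq_true, Bool.and_eq_true] at h
    rcases h with h | ⟨ha, hb⟩
    · rw [Nat.blt_eq] at h
      omega
    · rw [Finset.range_add_one, Finset.filter_insert] at hc
      split_ifs at hc with hbit
      · rw [Finset.card_insert_of_notMem (by simp)] at hc
        subst hc
        rw [Bool.or_eq_true, Nat.beq_eq] at hb
        have hb := hb.resolve_left (by omega)
        refine ih _ _ hb ?_ m' ?_ (by simp)
        · intro i hi
          rw [Nat.testBit_or, h0 i (by omega), Nat.testBit_two_pow]
          simp
          omega
        · intro i hi
          rw [Nat.testBit_or, Nat.testBit_two_pow]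
          rcases Nat.eq_or_lt_of_le hi with e | e
          · subst e
            simp [hbit]
          · rw [h' i e]
            have : n ≠ i := by omega
            simp [this]
      · refine ih _ _ ha (fun i hi => h0 i (by omega)) m' (fun i hi => ?_) hc
        rcases Nat.eq_or_lt_of_le hi with e | e
        · subst e
          rw [h0 n (by omega)]
          simpa using hbit
        · exact h' i e

theorem chk_ok : chk 16 10 0 = true := by decide +kernel

theorem mask_orbit (m : ℕ) : (∀ i, 16 ≤ i → m.testBit i = false) → (bitsF m).card = 10 →
    ∃ k ∈ mins, SameOrbit (setOfMask m) (setOfMask k) := by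
  induction m using Nat.strong_induction_on with
  | _ m ih =>
    intro h0 hc
    have ht := chk_spec 16 10 0 chk_ok (by simp) m (fun i hi => by rw [h0 i hi]; simp) hc
    rw [testM, Bool.or_eq_true, List.contains_iff_mem, List.any_eq_true] at ht
    rcases ht with ⟨sw, hsw, hlt⟩ | ht
    · rw [sws_eq] at hsw
      obtain ⟨G, hG, rfl⟩ := List.mem_map.1 hsw
      rw [Nat.blt_eq] at hlt
      obtain ⟨o, hcard⟩ := gen_orbit G (List.all_eq_true.1 gens_ok G hG) m
      have hm : m < 2 ^ 16 := Nat.lt_pow_two_of_testBit _ fun i hi => h0 i hi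
      obtain ⟨k, hk, o'⟩ := ih _ hlt
        (fun i hi => Nat.testBit_lt_two_pow ((hlt.trans hm).trans_le (Nat.pow_le_pow_right (by norm_num) hi)))
        (by rw [hcard, hc])
      exact ⟨k, hk, so_trans o o'⟩
    · exact ⟨m, ht, so_refl _⟩

/-! Part 6: invariants. -/

def Has (S : Finset Exc) (p : ℕ × ℕ) : Prop :=
  ∃ z : Exc, (S.filter fun s => Bx z s = 1).card = p.1 ∧ (S.filter fun s => Bx z s = 0).card = p.2

theorem Has_mono {S T : Finset Exc} (h : SameOrbit S T) {p : ℕ × ℕ} (hS : Has S p) : Has T p := by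
  obtain ⟨g, hg, rfl⟩ := h
  obtain ⟨z, h1, h2⟩ := hS
  refine ⟨g z, ?_, ?_⟩
  · rw [Finset.filter_image, Finset.card_image_of_injective _ g.injective, ← h1]
    simp only [hg z]
  · rw [Finset.filter_image, Finset.card_image_of_injective _ g.injective, ← h2]
    simp only [hg z]

def cnt (m : ℕ) (z : List ℤ) (w : ℤ) : ℕ :=
  (List.range 16).countP fun i => m.testBit i && Bl z (fl i) == w

theorem cnt_eq (m : ℕ) (z : Exc) (w : ℤ) :
    ((setOfMask m).filter fun s => Bx z s = w).card = cnt m (toL z.1) w := by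
  rw [setOfMask, Finset.filter_image, Finset.card_image_of_injOn
    ((f_injOn m).mono (by intro x hx; exact (Finset.mem_filter.1 hx).1)), bitsF,
    Finset.filter_filter, cnt, List.countP_eq_length_filter]
  have : (Finset.range 16).filter (fun i => m.testBit i = true ∧ Bx z (f i) = w) =
      ((List.range 16).filter fun i => m.testBit i && Bl (toL z.1) (fl i) == w).toFinset := by
    ext i
    simp [Bx_eq, toL_f]
  rw [this, List.toFinset_card_of_nodup]
  exact List.nodup_range.filter _

def hasB (m : ℕ) (p : ℕ × ℕ) : Bool :=
  all9.any fun z => Nat.beq (cnt m z 1) p.1 && Nat.beq (cnt m z 0) p.2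

theorem hasB_iff (m : ℕ) (p : ℕ × ℕ) : hasB m p = true ↔ Has (setOfMask m) p := by
  rw [hasB, List.any_eq_true]
  constructor
  · rintro ⟨l, hl, h⟩
    obtain ⟨z, rfl⟩ := mem_exc hl
    rw [Bool.and_eq_true, Nat.beq_eq, Nat.beq_eq, ← cnt_eq, ← cnt_eq] at h
    exact ⟨z, h⟩
  · rintro ⟨z, h⟩
    refine ⟨toL z.1, exc_mem z, ?_⟩
    rw [Bool.and_eq_true, Nat.beq_eq, Nat.beq_eq, ← cnt_eq, ← cnt_eq]
    exact h

def sig (m : ℕ) : List Bool := [(2, 4), (3, 3), (4, 2), (5, 1)].map (hasB m)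

theorem sig_table : mins.map sig = 
    [[false, false, true, true], [false, true, true, true], [false, false, true, false], [true, false, true, false], [false, true, true, false], [true, false, false, false]] := by decide +kernel

theorem sig_eq {m k : ℕ} (h : SameOrbit (setOfMask m) (setOfMask k)) : sig m = sig k := by
  have : ∀ p, hasB m p = hasB k p := fun p => by
    rw [Bool.eq_iff_iff, hasB_iff, hasB_iff]
    exact ⟨Has_mono h, Has_mono (so_symm h)⟩
  rw [sig, sig, funext this]

theorem mins_sep {m k : ℕ} (hm : m ∈ mins) (hk : k ∈ mins)
    (h : SameOrbit (setOfMask m) (setOfMask k)) : m = k := by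
  have hn : (mins.map sig).Nodup := by rw [sig_table]; decide
  exact List.inj_on_of_nodup_map hn hm hk (sig_eq h)

theorem frame_weights : ∀ i < 16, ∀ j < 16, i ≠ j → Bl (fl i) (fl j) = 1 ∨ Bl (fl i) (fl j) = 3 := by
  decide +kernel

theorem clique_mask (m : ℕ) : IsClique {1, 3} (setOfMask m) := by
  intro x hx y hy hxy
  obtain ⟨i, hi, rfl⟩ := Finset.mem_image.1 hx
  obtain ⟨j, hj, rfl⟩ := Finset.mem_image.1 hy
  rw [Bx_eq, toL_f, toL_f]
  exact frame_weights i (bitsF_lt hi) j (bitsF_lt hj) (fun e => hxy (by rw [e]))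

theorem mins_card : ∀ m ∈ mins, (bitsF m).card = 10 := by decide +kernel

/-- The action of `W` on the 10-element cliques in `C` with weights in `{1,3}` has
exactly 6 orbits. -/
theorem stmt7 :
    ∃ R : Finset (Finset Exc), R.card = 6 ∧
      (∀ S ∈ R, S.card = 10 ∧ IsClique {1, 3} S) ∧
      (∀ S : Finset Exc, S.card = 10 → IsClique {1, 3} S → ∃ T ∈ R, SameOrbit S T) ∧
      (∀ T₁ ∈ R, ∀ T₂ ∈ R, SameOrbit T₁ T₂ → T₁ = T₂) := by
  classical
  refine ⟨mins.toFinset.image setOfMask, ?_, ?_, ?_, ?_⟩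
  · rw [Finset.card_image_of_injOn]
    · rfl
    · intro a ha b hb hab
      have ha' : a ∈ mins := by simpa using ha
      have hb' : b ∈ mins := by simpa using hb
      exact mins_sep ha' hb' (by rw [hab]; exact so_refl _)
  · intro S hS
    obtain ⟨m, hm, rfl⟩ := Finset.mem_image.1 hS
    exact ⟨by rw [card_setOfMask]; exact mins_card m (List.mem_toFinset.1 hm), clique_mask m⟩
  · intro S hS hc
    obtain ⟨S', o, hS', hF⟩ := to_frame S hS hc
    obtain ⟨m, h0, rfl⟩ := exists_mask S' hF
    rw [card_setOfMask] at hS'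
    obtain ⟨k, hk, o'⟩ := mask_orbit m h0 hS'
    exact ⟨_, Finset.mem_image_of_mem _ (List.mem_toFinset.2 hk), so_trans o o'⟩
  · intro T₁ h1 T₂ h2 h
    obtain ⟨m, hm, rfl⟩ := Finset.mem_image.1 h1
    obtain ⟨k, hk, rfl⟩ := Finset.mem_image.1 h2
    rw [mins_sep (List.mem_toFinset.1 hm) (List.mem_toFinset.1 hk) h]
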